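/- (Injectivity of the restriction map on the dense parabolic orbit.) Let k be an integer with 2 ≤ k and 2k ≤ n, ε ∈ {1,−1}, and 1 ≤ i ≤ n−1. If g, g′ ∈ P_i satisfy trace((g·X_{k,ε}·g⁻¹)·Z) = trace((g′·X_{k,ε}·g′⁻¹)·Z) for all Z ∈ 𝔭_i, then g·X_{k,ε}·g⁻¹ = g′·X_{k,ε}·g′⁻¹. -/

import Mathlib

open Matrix

/-- The n×n real matrix unit `E_{a,b}` (1-based indices). -/
noncomputable def Ematrix (n a b : ℕ) : Matrix (Fin n) (Fin n) ℝ :=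
  fun s t => if (s : ℕ) + 1 = a ∧ (t : ℕ) + 1 = b then 1 else 0

/-- `X_{k,ε} = Σ_{i=1}^{k−1} E_{n+1−i,i} + ε·E_{n+1−k,k}`. -/
noncomputable def Xmat (n k : ℕ) (ε : ℝ) : Matrix (Fin n) (Fin n) ℝ :=
  (∑ i ∈ Finset.Icc 1 (k - 1), Ematrix n (n + 1 - i) i) + ε • Ematrix n (n + 1 - k) k

/-- Membership in the maximal parabolic subgroup `P_i ⊆ SL_n(ℝ)`:
the lower-left (n−i)×i block vanishes (1-based: entries (s,t) with s > i ≥ t are zero). -/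
def memP (n i : ℕ) (p : Matrix.SpecialLinearGroup (Fin n) ℝ) : Prop :=
  ∀ s t : Fin n, i ≤ (s : ℕ) → (t : ℕ) < i → p.val s t = 0

/-- The maximal parabolic subalgebra `𝔭_i ⊆ sl_n(ℝ)`, as a set. -/
def pSet (n i : ℕ) : Set (Matrix (Fin n) (Fin n) ℝ) :=
  {x | x.trace = 0 ∧ ∀ s t : Fin n, i ≤ (s : ℕ) → (t : ℕ) < i → x s t = 0}

lemma val_inv_mul_val {n : ℕ} (p : SpecialLinearGroup (Fin n) ℝ) : (p⁻¹).val * p.val = 1 :=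
  congrArg Subtype.val (inv_mul_cancel p)

lemma val_mul_val_inv {n : ℕ} (p : SpecialLinearGroup (Fin n) ℝ) : p.val * (p⁻¹).val = 1 :=
  congrArg Subtype.val (mul_inv_cancel p)

/-- The coordinate projection onto the span of the first `i` basis vectors. -/
noncomputable def coordProj (n i : ℕ) : Matrix (Fin n) (Fin n) ℝ :=
  diagonal fun s => if (s : ℕ) < i then 1 else 0

lemma coordProj_mul_apply {n i : ℕ} (M : Matrix (Fin n) (Fin n) ℝ) (s t : Fin n) :
    (coordProj n i * M) s t = if (s : ℕ) < i then M s t else 0 := by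
  simp [coordProj, diagonal_mul]

lemma mul_coordProj_apply {n i : ℕ} (M : Matrix (Fin n) (Fin n) ℝ) (s t : Fin n) :
    (M * coordProj n i) s t = if (t : ℕ) < i then M s t else 0 := by
  simp [coordProj, mul_diagonal]

lemma memP.inv {n i : ℕ} {p : SpecialLinearGroup (Fin n) ℝ} (hp : memP n i p) :
    memP n i p⁻¹ := by
  have hb : BlockTriangular p.val fun s => decide (i ≤ (s : ℕ)) := by
    intro s t hst
    obtain ⟨ht, hs⟩ := Bool.lt_iff.mp hst
    exact hp s t (by simpa using hs) (by simpa using ht)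
  have : Invertible p.val := invertibleOfIsUnitDet _ (by simp)
  have hinv := blockTriangular_inv_of_blockTriangular hb
  have hval : (p⁻¹).val = (p.val)⁻¹ := (inv_eq_right_inv (val_mul_val_inv p)).symm
  intro s t hs ht
  rw [hval]
  exact hinv (Bool.lt_iff.mpr ⟨by simpa using ht, by simpa using hs⟩)

lemma memP.mul_coordProj {n i : ℕ} {p : SpecialLinearGroup (Fin n) ℝ} (hp : memP n i p) :
    coordProj n i * (p.val * coordProj n i) = p.val * coordProj n i := by
  ext s t
  rw [coordProj_mul_apply, mul_coordProj_apply]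
  split_ifs with hs ht
  · rfl
  · rfl
  · exact (hp s t (by omega) (by assumption)).symm
  · rfl

lemma memP.mul {n i : ℕ} {p q : SpecialLinearGroup (Fin n) ℝ} (hp : memP n i p)
    (hq : memP n i q) : memP n i (p * q) := by
  intro s t hs ht
  change (p.val * q.val) s t = 0
  rw [mul_apply]
  refine Finset.sum_eq_zero fun j _ => ?_
  rcases lt_or_ge (j : ℕ) i with hj | hj
  · rw [hp s j hs hj, zero_mul]
  · rw [hq j t hj ht, mul_zero]

/-- Conjugation by the parabolic preserves its nilradical. -/
lemma memP.conj_nilradical {n i : ℕ} {p : SpecialLinearGroup (Fin n) ℝ} (hp : memP n i p)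
    {M : Matrix (Fin n) (Fin n) ℝ} (hl : coordProj n i * M = M) (hr : M * coordProj n i = 0) :
    coordProj n i * (p.val * M * (p⁻¹).val) = p.val * M * (p⁻¹).val ∧
      p.val * M * (p⁻¹).val * coordProj n i = 0 := by
  constructor
  · calc coordProj n i * (p.val * M * (p⁻¹).val)
        = coordProj n i * (p.val * (coordProj n i * M) * (p⁻¹).val) := by rw [hl]
      _ = (coordProj n i * (p.val * coordProj n i)) * M * (p⁻¹).val := by
        simp only [Matrix.mul_assoc]
      _ = p.val * (coordProj n i * M) * (p⁻¹).val := by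
        rw [hp.mul_coordProj]; simp only [Matrix.mul_assoc]
      _ = _ := by rw [hl]
  · rw [Matrix.mul_assoc, ← hp.inv.mul_coordProj, ← Matrix.mul_assoc, Matrix.mul_assoc p.val, hr,
      Matrix.mul_zero, Matrix.zero_mul]

/-- The annihilator of `𝔭_i` among traceless matrices is the nilradical. -/
lemma apply_eq_zero_of_trace_mul_eq_zero {n i : ℕ} {M : Matrix (Fin n) (Fin n) ℝ}
    (htr : M.trace = 0) (h : ∀ Z ∈ pSet n i, (M * Z).trace = 0) {s t : Fin n}
    (hst : ¬((s : ℕ) < i ∧ i ≤ (t : ℕ))) : M s t = 0 := by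
  have hn : (n : ℝ) ≠ 0 := by
    have := s.pos
    positivity
  have hZ := h (single t s 1 - ((single t s (1 : ℝ)).trace / n) • 1) ⟨by
    simp [trace_sub, trace_smul, hn], by
    intro a b ha hb
    have hab : a ≠ b := by rintro rfl; omega
    have : ¬(t = a ∧ s = b) := by rintro ⟨rfl, rfl⟩; exact hst ⟨hb, ha⟩
    simp [this, one_apply, hab]⟩
  simpa [Matrix.mul_sub, trace_sub, trace_smul, htr, trace_mul_single] using hZ

lemma Xmat_apply {n k : ℕ} (hk : 1 ≤ k) (hkn : 2 * k ≤ n) (ε : ℝ) (s t : Fin n) :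
    Xmat n k ε s t =
      if t = s.rev ∧ (t : ℕ) < k then (if (t : ℕ) + 1 = k then ε else 1) else 0 := by
  have hs := s.isLt
  have ht := t.isLt
  have hsum : (∑ j ∈ Finset.Icc 1 (k - 1), Ematrix n (n + 1 - j) j s t) =
      if (t : ℕ) + 1 ∈ Finset.Icc 1 (k - 1) then Ematrix n (n + 1 - (t + 1)) (t + 1) s t else 0 := by
    split_ifs with hmem
    · refine Finset.sum_eq_single_of_mem _ hmem fun j _ hj => ?_
      exact if_neg fun hh => hj hh.2.symm
    · refine Finset.sum_eq_zero fun j hj => ?_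
      refine if_neg fun hh => hmem ?_
      rw [hh.2]
      exact hj
  rw [Xmat, Matrix.add_apply, Matrix.sum_apply, hsum]
  simp only [Matrix.smul_apply, smul_eq_mul, Finset.mem_Icc, Ematrix, Fin.ext_iff, Fin.val_rev,
    and_true]
  split_ifs <;> first | omega | simp

lemma Xmat_mul_apply_rev {n k : ℕ} (hk : 1 ≤ k) (hkn : 2 * k ≤ n) (ε : ℝ)
    (M : Matrix (Fin n) (Fin n) ℝ) (a t : Fin n) (ha : (a : ℕ) < k) :
    (Xmat n k ε * M) a.rev t = (if (a : ℕ) + 1 = k then ε else 1) * M a t := by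
  rw [mul_apply, Finset.sum_eq_single a]
  · rw [Xmat_apply hk hkn, if_pos ⟨(Fin.rev_rev a).symm, ha⟩]
  · intro b _ hb
    rw [Xmat_apply hk hkn, if_neg (fun hh => hb (by simpa using hh.1)), zero_mul]
  · simp

lemma mul_Xmat_apply {n k : ℕ} (hk : 1 ≤ k) (hkn : 2 * k ≤ n) (ε : ℝ)
    (M : Matrix (Fin n) (Fin n) ℝ) (s a : Fin n) (ha : (a : ℕ) < k) :
    (M * Xmat n k ε) s a = M s a.rev * (if (a : ℕ) + 1 = k then ε else 1) := by
  rw [mul_apply, Finset.sum_eq_single a.rev]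
  · rw [Xmat_apply hk hkn, if_pos ⟨(Fin.rev_rev a).symm, ha⟩]
  · intro b _ hb
    rw [Xmat_apply hk hkn, if_neg (fun hh => hb (by rw [hh.1, Fin.rev_rev])), mul_zero]
  · simp

lemma Xmat_mul_self {n k : ℕ} (hk : 1 ≤ k) (hkn : 2 * k ≤ n) (ε : ℝ) :
    Xmat n k ε * Xmat n k ε = 0 := by
  ext s t
  rw [mul_apply, Matrix.zero_apply]
  refine Finset.sum_eq_zero fun j _ => ?_
  have hj := j.isLt
  have ht := t.isLt
  rw [Xmat_apply hk hkn, Xmat_apply hk hkn, mul_eq_zero, or_iff_not_imp_left]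
  intro h1
  refine if_neg fun h2 => h1 (if_neg fun h3 => ?_)
  have := congrArg Fin.val h2.1
  rw [Fin.val_rev] at this
  omega

/-- A parabolic conjugate of `X_{k,ε}` that differs from `X_{k,ε}` by an element of the nilradical
is `X_{k,ε}` itself. -/
lemma eq_zero_of_conj_eq_Xmat_sub {n k i : ℕ} (hk : 1 ≤ k) (hkn : 2 * k ≤ n) {ε : ℝ}
    (hε : ε ≠ 0) {p : SpecialLinearGroup (Fin n) ℝ} (hp : memP n i p)
    {M : Matrix (Fin n) (Fin n) ℝ} (hl : coordProj n i * M = M) (hr : M * coordProj n i = 0)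
    (hM : p.val * Xmat n k ε * (p⁻¹).val = Xmat n k ε - M) : M = 0 := by
  have hinv := val_inv_mul_val p
  have hsq := Xmat_mul_self hk hkn ε
  have hMM : M * M = 0 := by
    rw [← hl, ← Matrix.mul_assoc, Matrix.mul_assoc _ M, hr, Matrix.mul_zero, Matrix.zero_mul]
  have hanti : Xmat n k ε * M = -(M * Xmat n k ε) := by
    have h0 : (Xmat n k ε - M) * (Xmat n k ε - M) = 0 := by
      rw [← hM]
      calc _ = p.val * Xmat n k ε * ((p⁻¹).val * p.val) * Xmat n k ε * (p⁻¹).val := by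
            simp only [Matrix.mul_assoc]
        _ = p.val * (Xmat n k ε * Xmat n k ε) * (p⁻¹).val := by
            rw [hinv, Matrix.mul_one]; simp only [Matrix.mul_assoc]
        _ = 0 := by rw [hsq, Matrix.mul_zero, Matrix.zero_mul]
    rw [Matrix.sub_mul, Matrix.mul_sub, Matrix.mul_sub, hsq, hMM] at h0
    rw [eq_neg_iff_add_eq_zero, ← neg_eq_zero, ← h0]
    abel
  have hrow (s t : Fin n) (hs : i ≤ (s : ℕ)) : M s t = 0 := by
    rw [← hl, coordProj_mul_apply, if_neg (by omega)]
  have hcol (s t : Fin n) (ht : (t : ℕ) < i) : M s t = 0 := by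
    have := congrFun₂ hr s t
    rwa [mul_coordProj_apply, if_pos ht] at this
  have hc (a : Fin n) : (if (a : ℕ) + 1 = k then ε else 1) ≠ 0 := by
    split_ifs
    · exact hε
    · exact one_ne_zero
  rcases lt_or_ge i k with hik | hki
  · ext a t
    rcases lt_or_ge (a : ℕ) i with ha | ha
    · have h1 := congrFun₂ hanti a.rev t
      have h2 : (M * Xmat n k ε) a.rev t = 0 := by
        rw [mul_apply]
        refine Finset.sum_eq_zero fun j _ => ?_
        rw [hrow _ _ (by rw [Fin.val_rev]; omega), zero_mul]
      rw [Xmat_mul_apply_rev hk hkn ε M a t (by omega), Matrix.neg_apply, h2, neg_zero] at h1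
      exact (mul_eq_zero.mp h1).resolve_left (hc a)
    · exact hrow a t ha
  rcases lt_or_ge n (k + i) with hni | hni
  · ext s t
    rcases lt_or_ge (t : ℕ) i with ht | ht
    · exact hcol s t ht
    · have h1 := congrFun₂ hanti s t.rev
      have h2 : (Xmat n k ε * M) s t.rev = 0 := by
        rw [mul_apply]
        refine Finset.sum_eq_zero fun j _ => ?_
        rw [hcol _ _ (by rw [Fin.val_rev]; omega), mul_zero]
      rw [h2, Matrix.neg_apply, mul_Xmat_apply hk hkn ε M s t.rev (by rw [Fin.val_rev]; omega),
        zero_eq_neg, Fin.rev_rev] at h1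
      exact (mul_eq_zero.mp h1).resolve_right (hc _)
  · have hXE : Xmat n k ε * coordProj n i = Xmat n k ε := by
      ext s t
      rw [mul_coordProj_apply]
      split_ifs with ht
      · rfl
      · rw [Xmat_apply hk hkn, if_neg (by omega)]
    have hEX : coordProj n i * Xmat n k ε = 0 := by
      ext s t
      rw [coordProj_mul_apply, Matrix.zero_apply]
      split_ifs with hs
      · rw [Xmat_apply hk hkn, if_neg]
        rintro ⟨h1, h2⟩
        rw [h1, Fin.val_rev] at h2
        omega
      · rfl
    have hneg : (Xmat n k ε - M) * (1 - coordProj n i) = -M := by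
      rw [Matrix.mul_sub, Matrix.sub_mul _ _ (coordProj n i), hXE, hr, Matrix.mul_one]
      abel
    set G := p.val * coordProj n i * (p⁻¹).val with hG
    have hGY : G * (Xmat n k ε - M) = 0 := by
      rw [← hM, hG]
      calc _ = p.val * coordProj n i * ((p⁻¹).val * p.val) * Xmat n k ε * (p⁻¹).val := by
            simp only [Matrix.mul_assoc]
        _ = p.val * (coordProj n i * Xmat n k ε) * (p⁻¹).val := by
            rw [hinv, Matrix.mul_one]; simp only [Matrix.mul_assoc]
        _ = 0 := by rw [hEX, Matrix.mul_zero, Matrix.zero_mul]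
    have hGE : G * coordProj n i = coordProj n i := by
      rw [hG, Matrix.mul_assoc, Matrix.mul_assoc, hp.inv.mul_coordProj, ← Matrix.mul_assoc,
        val_mul_val_inv, Matrix.one_mul]
    have hGM : G * M = M := by rw [← hl, ← Matrix.mul_assoc, hGE]
    have h0 : G * -M = 0 := by rw [← hneg, ← Matrix.mul_assoc, hGY, Matrix.zero_mul]
    rwa [Matrix.mul_neg, hGM, neg_eq_zero] at h0

theorem restriction_injective_on_parabolic_orbit (n : ℕ) (hn : 4 ≤ n) (k : ℕ)
    (hk : 2 ≤ k) (hkn : 2 * k ≤ n) (ε : ℝ) (hε : ε = 1 ∨ ε = -1)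
    (i : ℕ) (hi1 : 1 ≤ i) (hi2 : i ≤ n - 1)
    (g g' : Matrix.SpecialLinearGroup (Fin n) ℝ) (hg : memP n i g) (hg' : memP n i g')
    (h : ∀ Z ∈ pSet n i,
      ((g.val * Xmat n k ε * (g⁻¹).val) * Z).trace =
        ((g'.val * Xmat n k ε * (g'⁻¹).val) * Z).trace) :
    g.val * Xmat n k ε * (g⁻¹).val = g'.val * Xmat n k ε * (g'⁻¹).val := by
  have htrace (p : SpecialLinearGroup (Fin n) ℝ) :
      (p.val * Xmat n k ε * (p⁻¹).val).trace = (Xmat n k ε).trace := by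
    rw [trace_mul_comm, ← Matrix.mul_assoc, val_inv_mul_val, Matrix.one_mul]
  set D := g.val * Xmat n k ε * (g⁻¹).val - g'.val * Xmat n k ε * (g'⁻¹).val with hD
  have hDapply {s t : Fin n} (hst : ¬((s : ℕ) < i ∧ i ≤ (t : ℕ))) : D s t = 0 := by
    refine apply_eq_zero_of_trace_mul_eq_zero ?_ (fun Z hZ => ?_) hst
    · rw [hD, trace_sub, htrace, htrace, sub_self]
    · rw [hD, Matrix.sub_mul, trace_sub, h Z hZ, sub_self]
  have hDl : coordProj n i * D = D := by
    ext s t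
    rw [coordProj_mul_apply]
    split_ifs with hs
    · rfl
    · exact (hDapply fun hh => hs hh.1).symm
  have hDr : D * coordProj n i = 0 := by
    ext s t
    rw [mul_coordProj_apply, Matrix.zero_apply]
    split_ifs with ht
    · exact hDapply (by omega)
    · rfl
  obtain ⟨hl, hr⟩ := hg.inv.conj_nilradical hDl hDr
  rw [inv_inv] at hl hr
  have hzero := eq_zero_of_conj_eq_Xmat_sub (ε := ε) (by omega) hkn
    (by rcases hε with rfl | rfl <;> norm_num) (hg.inv.mul hg') hl hr (by
      rw [_root_.mul_inv_rev, inv_inv, hD, Matrix.mul_sub, Matrix.sub_mul]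
      have : (g⁻¹).val * (g.val * Xmat n k ε * (g⁻¹).val) * g.val = Xmat n k ε := by
        calc _ = ((g⁻¹).val * g.val) * Xmat n k ε * ((g⁻¹).val * g.val) := by
              simp only [Matrix.mul_assoc]
          _ = _ := by rw [val_inv_mul_val, Matrix.one_mul, Matrix.mul_one]
      rw [this, sub_sub_cancel]
      change (g⁻¹).val * g'.val * Xmat n k ε * ((g'⁻¹).val * g.val) = _
      simp only [Matrix.mul_assoc])
  refine sub_eq_zero.mp ?_
  calc D = (g.val * (g⁻¹).val) * D * (g.val * (g⁻¹).val) := by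
        rw [val_mul_val_inv, Matrix.one_mul, Matrix.mul_one]
    _ = g.val * ((g⁻¹).val * D * g.val) * (g⁻¹).val := by simp only [Matrix.mul_assoc]
    _ = 0 := by rw [hzero, Matrix.mul_zero, Matrix.zero_mul]
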